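/- arXiv:2101.08399 — 4 statements merged into one kernel-verified Lean document; each statement's English description precedes it below -/
import Mathlib

section
/- Let ε > 0 and 0 < h̄ ≤ 1. Suppose h : ℝ → ℝ is a twice continuously differentiable, 1-periodic, strictly positive function satisfying ε² h''(x) + f(h(x)) − ∫₀¹ f(h(t)) dt = 0 for all x, together with the volume constraint ∫₀¹ h(x) dx = h̄, where f(h) = h⁻⁶ − h⁻³. Then h is constant, i.e. h(x) = h̄ for all x. (Proposition 2: the steady-state problem has no nontrivial solutions when h̄ ≤ 1.) -/
open Real

/-- At a local minimum, the second derivative of a continuous function is nonnegative. -/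
theorem IsLocalMin.deriv_deriv_nonneg {g : ℝ → ℝ} {a : ℝ} (ha : IsLocalMin g a)
    (hg : ContinuousAt g a) : 0 ≤ deriv (deriv g) a := by
  by_contra! hlt
  have hmax : IsLocalMax g a := isLocalMax_of_deriv_deriv_neg hlt ha.deriv_eq_zero hg
  have hconst : g =ᶠ[nhds a] fun _ => g a := by
    filter_upwards [ha, hmax] with x hx hx' using le_antisymm hx' hx
  have : deriv (deriv g) a = 0 := by
    rw [hconst.deriv.deriv_eq]
    simp
  linarith

/-- At a local maximum, the second derivative of a continuous function is nonpositive. -/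
theorem IsLocalMax.deriv_deriv_nonpos {g : ℝ → ℝ} {a : ℝ} (ha : IsLocalMax g a)
    (hg : ContinuousAt g a) : deriv (deriv g) a ≤ 0 := by
  by_contra! hlt
  have hmin : IsLocalMin g a := isLocalMin_of_deriv_deriv_pos hlt ha.deriv_eq_zero hg
  have hconst : g =ᶠ[nhds a] fun _ => g a := by
    filter_upwards [ha, hmin] with x hx hx' using le_antisymm hx hx'
  have : deriv (deriv g) a = 0 := by
    rw [hconst.deriv.deriv_eq]
    simp
  linarith

/-- A continuous `1`-periodic real function attains its minimum. -/
theorem Function.Periodic.exists_forall_le_of_continuous {g : ℝ → ℝ}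
    (hper : Function.Periodic g 1) (hg : Continuous g) : ∃ a, ∀ x, g a ≤ g x := by
  obtain ⟨a, -, ha⟩ := isCompact_Icc.exists_isMinOn
    (Set.nonempty_Icc.2 (zero_le_one' ℝ)) hg.continuousOn
  refine ⟨a, fun x => ?_⟩
  obtain ⟨y, hy, hxy⟩ := hper.exists_mem_Ico₀ one_pos x
  rw [hxy]
  exact ha (Set.Ico_subset_Icc_self hy)

/-- The Derjaguin disjoining pressure at a thickness below `1` exceeds its value at every larger
thickness. -/
theorem disjoining_pressure_lt {m M : ℝ} (hm : 0 < m) (hm1 : m < 1) (hmM : m < M) :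
    1 / M ^ 6 - 1 / M ^ 3 < 1 / m ^ 6 - 1 / m ^ 3 := by
  have hM : 0 < M := hm.trans hmM
  have hu : 1 < 1 / m ^ 3 := by
    rw [lt_div_iff₀ (by positivity), one_mul]
    exact pow_lt_one₀ hm.le hm1 (by norm_num)
  have hv : 1 / M ^ 3 < 1 / m ^ 3 := by gcongr
  have hv0 : 0 < 1 / M ^ 3 := by positivity
  have hm6 : 1 / m ^ 6 = (1 / m ^ 3) ^ 2 := by rw [div_pow, ← pow_mul, one_pow]
  have hM6 : 1 / M ^ 6 = (1 / M ^ 3) ^ 2 := by rw [div_pow, ← pow_mul, one_pow]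
  rw [hm6, hM6]
  nlinarith

/-- A continuous function that is at least `c` on `[0, 1]` and has mean at most `c` there equals
`c` on `[0, 1]`. -/
theorem eq_of_le_of_intervalIntegral_le {g : ℝ → ℝ} {c : ℝ} (hg : Continuous g)
    (hc : ∀ x, c ≤ g x) (hint : ∫ x in (0 : ℝ)..1, g x ≤ c) {x : ℝ}
    (hx : x ∈ Set.Icc (0 : ℝ) 1) : g x = c := by
  by_contra hne
  have hlt : ∫ _ in (0 : ℝ)..1, c < ∫ x in (0 : ℝ)..1, g x :=
    intervalIntegral.integral_lt_integral_of_continuousOn_of_le_of_exists_lt one_pos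
      continuousOn_const hg.continuousOn (fun y _ => hc y)
      ⟨x, hx, lt_of_le_of_ne (hc x) (Ne.symm hne)⟩
  simp at hlt
  linarith

theorem no_nontrivial_solutions_for_small_mean
    (ε hbar : ℝ) (hε : 0 < ε) (hbar_pos : 0 < hbar) (hbar_le : hbar ≤ 1)
    (f : ℝ → ℝ) (hf : ∀ y : ℝ, f y = 1 / y ^ 6 - 1 / y ^ 3)
    (h : ℝ → ℝ) (hC2 : ContDiff ℝ 2 h) (hper : Function.Periodic h 1)
    (hpos : ∀ x, 0 < h x)
    (hode : ∀ x, ε ^ 2 * deriv (deriv h) x + f (h x) - ∫ t in (0:ℝ)..1, f (h t) = 0)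
    (hvol : (∫ x in (0:ℝ)..1, h x) = hbar) :
    ∀ x, h x = hbar := by
  have hcont : Continuous h := hC2.continuous
  suffices hconst : ∃ c, ∀ x, h x = c by
    obtain ⟨c, hc⟩ := hconst
    have hbar_eq : hbar = c := by rw [← hvol]; simp [hc]
    simpa [hbar_eq] using hc
  obtain ⟨a, ha⟩ := hper.exists_forall_le_of_continuous hcont
  obtain ⟨b, hb⟩ : ∃ b, ∀ x, h x ≤ h b := by
    obtain ⟨b, hb⟩ := Function.Periodic.exists_forall_le_of_continuous
      (g := fun x => -h x) (fun x => by simp [hper x]) hcont.neg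
    exact ⟨b, fun x => neg_le_neg_iff.1 (hb x)⟩
  rcases lt_or_ge (h a) 1 with hlt | hge
  · have ha2 : 0 ≤ deriv (deriv h) a :=
      IsLocalMin.deriv_deriv_nonneg (Filter.Eventually.of_forall ha) hcont.continuousAt
    have hb2 : deriv (deriv h) b ≤ 0 :=
      IsLocalMax.deriv_deriv_nonpos (Filter.Eventually.of_forall hb) hcont.continuousAt
    have hfab : f (h a) ≤ f (h b) := by
      have hεa := mul_nonneg (sq_nonneg ε) ha2
      have hεb := mul_nonpos_of_nonneg_of_nonpos (sq_nonneg ε) hb2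
      linarith [hode a, hode b]
    have hba : h b ≤ h a := by
      by_contra! hab
      have := disjoining_pressure_lt (hpos a) hlt hab
      rw [← hf, ← hf] at this
      linarith
    exact ⟨h a, fun x => le_antisymm ((hb x).trans hba) (ha x)⟩
  · refine ⟨1, fun x => ?_⟩
    obtain ⟨y, hy, hxy⟩ := hper.exists_mem_Ico₀ one_pos x
    rw [hxy]
    exact eq_of_le_of_intervalIntegral_le hcont (fun z => hge.trans (ha z))
      (hvol.trans_le hbar_le) (Set.Ico_subset_Icc_self hy)
end

section
/- Let f(h) = h⁻⁶ − h⁻³ and let h̄ > 0 satisfy h̄³ > 2, and set Λ(h̄) := (3/8) f'''(h̄) + (1/8) f''(h̄)² / f'(h̄). Then Λ(h̄) < 0 if and only if (71 − 3√102)/19 < h̄³ < (71 + 3√102)/19, and Λ(h̄) > 0 if and only if 2 < h̄³ < (71 − 3√102)/19 or h̄³ > (71 + 3√102)/19. (Numerically these thresholds are h̄ ≈ 1.289 and h̄ ≈ 1.747: bifurcations of nontrivial solutions from the constant solution are supercritical for 1.289 < h̄ < 1.747 and subcritical for 2^{1/3} < h̄ < 1.289 or h̄ > 1.747; this is Proposition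 1.) -/
open Real

lemma hasDerivAt_zpow_comb (a b : ℝ) (m n : ℤ) {x : ℝ} (hx : x ≠ 0) :
    HasDerivAt (fun y : ℝ => a * y ^ m + b * y ^ n)
      (a * m * x ^ (m - 1) + b * n * x ^ (n - 1)) x := by
  have h := ((hasDerivAt_zpow m x (Or.inl hx)).const_mul a).add
    ((hasDerivAt_zpow n x (Or.inl hx)).const_mul b)
  exact h.congr_deriv (by ring)

lemma deriv_eq_zpow_comb {g : ℝ → ℝ} {a b : ℝ} {m n : ℤ}
    (hg : ∀ y, 0 < y → g y = a * y ^ m + b * y ^ n) {x : ℝ} (hx : 0 < x) :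
    deriv g x = a * m * x ^ (m - 1) + b * n * x ^ (n - 1) := by
  have h : g =ᶠ[nhds x] fun y => a * y ^ m + b * y ^ n := by
    filter_upwards [lt_mem_nhds hx] with y hy using hg y hy
  rw [h.deriv_eq, (hasDerivAt_zpow_comb a b m n hx.ne').deriv]

/-- The quadratic `19 y ^ 2 - 142 y + 217` in factored form. -/
lemma quadratic_factorization (y : ℝ) :
    19 * y ^ 2 - 142 * y + 217 =
      19 * ((y - (71 - 3 * √102) / 19) * (y - (71 + 3 * √102) / 19)) := by
  have hs : √102 ^ 2 = (102 : ℝ) := Real.sq_sqrt (by norm_num)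
  linear_combination (9 / 19 : ℝ) * hs

theorem cubic_coefficient_sign
    (f : ℝ → ℝ) (hf : ∀ y : ℝ, f y = 1 / y ^ 6 - 1 / y ^ 3)
    (hbar : ℝ) (hbar_pos : 0 < hbar) (hbar_cube : 2 < hbar ^ 3)
    (Λ : ℝ) (hΛ : Λ = (3 / 8) * deriv (deriv (deriv f)) hbar
        + (1 / 8) * (deriv (deriv f) hbar) ^ 2 / deriv f hbar) :
    (Λ < 0 ↔ (71 - 3 * Real.sqrt 102) / 19 < hbar ^ 3 ∧
        hbar ^ 3 < (71 + 3 * Real.sqrt 102) / 19) ∧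
    (0 < Λ ↔ (2 < hbar ^ 3 ∧ hbar ^ 3 < (71 - 3 * Real.sqrt 102) / 19) ∨
        (71 + 3 * Real.sqrt 102) / 19 < hbar ^ 3) := by
  have h0 : ∀ y : ℝ, 0 < y → f y = 1 * y ^ (-6 : ℤ) + (-1) * y ^ (-3 : ℤ) := by
    intro y _
    simp only [hf, zpow_neg, one_div, one_mul, neg_one_mul, sub_eq_add_neg]
    norm_cast
  have h1 := fun y (hy : 0 < y) => deriv_eq_zpow_comb h0 hy
  have h2 := fun y (hy : 0 < y) => deriv_eq_zpow_comb h1 hy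
  have h3 := deriv_eq_zpow_comb h2 hbar_pos
  have e1 : deriv f hbar = 3 * (hbar ^ 3 - 2) / hbar ^ 7 := by
    rw [h1 hbar hbar_pos]
    norm_num [zpow_neg]
    norm_cast
    field_simp
    ring
  have e2 : deriv (deriv f) hbar = 6 * (7 - 2 * hbar ^ 3) / hbar ^ 8 := by
    rw [h2 hbar hbar_pos]
    norm_num [zpow_neg]
    norm_cast
    field_simp
    ring
  have e3 : deriv (deriv (deriv f)) hbar = 12 * (5 * hbar ^ 3 - 28) / hbar ^ 9 := by
    rw [h3]
    norm_num [zpow_neg]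
    norm_cast
    field_simp
    ring
  have hd : 0 < hbar ^ 3 - 2 := sub_pos.2 hbar_cube
  set r := (71 - 3 * √102) / 19 with hr
  set s := (71 + 3 * √102) / 19 with hs
  have hrs : r < s := by
    have : 0 < √(102 : ℝ) := Real.sqrt_pos.2 (by norm_num)
    rw [hr, hs]
    linarith
  have hΛ' : Λ = 57 / (2 * hbar ^ 9 * (hbar ^ 3 - 2)) * ((hbar ^ 3 - r) * (hbar ^ 3 - s)) := by
    have hq := quadratic_factorization (hbar ^ 3)
    have : (hbar ^ 3 - r) * (hbar ^ 3 - s) =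
        (19 * (hbar ^ 3) ^ 2 - 142 * hbar ^ 3 + 217) / 19 := by
      rw [hq]; ring
    rw [hΛ, e1, e2, e3, this]
    have hd' := hd.ne'
    field_simp
    ring
  have hc : 0 < 57 / (2 * hbar ^ 9 * (hbar ^ 3 - 2)) := by positivity
  rw [hΛ', ← neg_pos, ← mul_neg, mul_pos_iff_of_pos_left hc, neg_pos, mul_pos_iff_of_pos_left hc, mul_neg_iff, mul_pos_iff]
  simp only [sub_pos, sub_neg]
  grind
end

section
/- Let h₀ : ℝ → ℝ be a continuously differentiable, 1-periodic, strictly positive function, and define F(x) = h₀(x)⁻⁶ h₀'(x). Suppose that (a, b) ≠ (0, 0), where a = ∫₀¹ F(y) sin(2πy) dy and b = ∫₀¹ F(y) cos(2πy) dy. Then the set { s ∈ [0, 1) : ∫₀¹ F(x + s) sin(2πx) dx = 0 } has exactly two elements. (Thus, under forced symmetry breaking by the striped wettability pattern G(x) = sin(2πx), exactly two steady states survive from the O(2) orbit { h₀(· + s) : s ∈ ℝ/[0,1] } of steady-state solutions of the homogeneous problem.) -/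
open Real

/-- The correlation of a continuous 1-periodic function with the shifted first sine mode
is a combination of its first Fourier coefficients. -/
theorem integral_comp_add_mul_sin {F : ℝ → ℝ} (hF : Continuous F) (hper : Function.Periodic F 1)
    (s : ℝ) :
    (∫ x in (0:ℝ)..1, F (x + s) * Real.sin (2 * π * x)) =
      (∫ y in (0:ℝ)..1, F y * Real.sin (2 * π * y)) * Real.cos (2 * π * s) -
        (∫ y in (0:ℝ)..1, F y * Real.cos (2 * π * y)) * Real.sin (2 * π * s) := by
  have hG : Function.Periodic (fun y => F y * Real.sin (2 * π * (y - s))) 1 := by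
    intro y
    have h : 2 * π * (y + 1 - s) = 2 * π * (y - s) + 2 * π := by ring
    simp only [hper y, h, Real.sin_add_two_pi]
  calc (∫ x in (0:ℝ)..1, F (x + s) * Real.sin (2 * π * x))
      = ∫ x in (0:ℝ)..1, (fun y => F y * Real.sin (2 * π * (y - s))) (x + s) := by
        simp only [add_sub_cancel_right]
    _ = ∫ y in s..s + 1, F y * Real.sin (2 * π * (y - s)) := by
        rw [intervalIntegral.integral_comp_add_right (fun y => F y * Real.sin (2 * π * (y - s))),
          zero_add, add_comm]
    _ = ∫ y in (0:ℝ)..1, F y * Real.sin (2 * π * (y - s)) := by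
        simpa using hG.intervalIntegral_add_eq s 0
    _ = ∫ y in (0:ℝ)..1, (F y * Real.sin (2 * π * y) * Real.cos (2 * π * s) -
          F y * Real.cos (2 * π * y) * Real.sin (2 * π * s)) := by
        congr 1 with y
        rw [mul_sub, Real.sin_sub]
        ring
    _ = _ := by
        rw [intervalIntegral.integral_sub, intervalIntegral.integral_mul_const,
          intervalIntegral.integral_mul_const]
        all_goals exact Continuous.intervalIntegrable (by fun_prop) _ _

/-- A nontrivial first harmonic has exactly two zeros per period. -/
theorem ncard_zeros_first_harmonic {a b : ℝ} (hab : (a, b) ≠ (0, 0)) :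
    {s ∈ Set.Ico (0:ℝ) 1 |
      a * Real.cos (2 * π * s) - b * Real.sin (2 * π * s) = 0}.ncard = 2 := by
  have hz : (⟨b, a⟩ : ℂ) ≠ 0 := by
    intro h
    rw [Complex.ext_iff] at h
    exact hab (Prod.ext h.2 h.1)
  set r := ‖(⟨b, a⟩ : ℂ)‖
  set c := Complex.arg ⟨b, a⟩ / (2 * π) with hc
  have hφ : Complex.arg ⟨b, a⟩ = 2 * π * c := by
    rw [hc]
    field_simp
  have hr : r ≠ 0 := norm_ne_zero_iff.mpr hz
  have hb : r * Real.cos (2 * π * c) = b := hφ ▸ Complex.norm_mul_cos_arg ⟨b, a⟩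
  have ha : r * Real.sin (2 * π * c) = a := hφ ▸ Complex.norm_mul_sin_arg ⟨b, a⟩
  have hzero (s : ℝ) : a * Real.cos (2 * π * s) - b * Real.sin (2 * π * s) = 0 ↔
      ∃ n : ℤ, c - s = n / 2 := by
    have h : a * Real.cos (2 * π * s) - b * Real.sin (2 * π * s) =
        r * Real.sin (2 * π * c - 2 * π * s) := by
      rw [Real.sin_sub, ← ha, ← hb]
      ring
    rw [h, mul_eq_zero, or_iff_right hr, Real.sin_eq_zero_iff]
    refine exists_congr fun n => ⟨fun hn => ?_, fun hn => ?_⟩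
    · apply mul_left_cancel₀ Real.two_pi_pos.ne'
      linarith
    · linear_combination -(2 * π) * hn
  have hne : Int.fract c ≠ Int.fract (c + 1 / 2) := by
    rw [Ne, Int.fract_eq_fract]
    rintro ⟨n, hn⟩
    have h : ((2 * n : ℤ) : ℝ) = (-1 : ℤ) := by
      push_cast
      linarith
    have := Int.cast_injective h
    omega
  rw [← Set.ncard_pair hne]
  congr 1
  ext s
  simp only [Set.mem_ofPred_eq, Set.mem_insert_iff, Set.mem_singleton_iff, hzero]
  constructor
  · rintro ⟨⟨h0, h1⟩, n, hn⟩
    rcases Int.even_or_odd' n with ⟨k, rfl | rfl⟩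
    · refine Or.inl (Int.fract_eq_iff.mpr ⟨h0, h1, k, ?_⟩).symm
      push_cast at hn
      linarith
    · refine Or.inr (Int.fract_eq_iff.mpr ⟨h0, h1, k + 1, ?_⟩).symm
      push_cast at hn ⊢
      linarith
  · rintro (rfl | rfl)
    · refine ⟨⟨Int.fract_nonneg _, Int.fract_lt_one _⟩, 2 * ⌊c⌋, ?_⟩
      push_cast
      linarith [Int.self_sub_floor c]
    · refine ⟨⟨Int.fract_nonneg _, Int.fract_lt_one _⟩, 2 * ⌊c + 1 / 2⌋ - 1, ?_⟩
      push_cast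
      linarith [Int.self_sub_floor (c + 1 / 2)]

theorem two_surviving_steady_states
    (h₀ : ℝ → ℝ) (hC1 : ContDiff ℝ 1 h₀) (hper : Function.Periodic h₀ 1)
    (hpos : ∀ x, 0 < h₀ x)
    (F : ℝ → ℝ) (hF : ∀ x, F x = (1 / (h₀ x) ^ 6) * deriv h₀ x)
    (a b : ℝ)
    (ha : a = ∫ y in (0:ℝ)..1, F y * Real.sin (2 * π * y))
    (hb : b = ∫ y in (0:ℝ)..1, F y * Real.cos (2 * π * y))
    (hab : (a, b) ≠ (0, 0)) :
    {s ∈ Set.Ico (0:ℝ) 1 |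
        (∫ x in (0:ℝ)..1, F (x + s) * Real.sin (2 * π * x)) = 0}.ncard = 2 := by
  have hFeq : F = fun x => (1 / (h₀ x) ^ 6) * deriv h₀ x := funext hF
  have hcont : Continuous F := by
    rw [hFeq]
    exact (continuous_const.div (hC1.continuous.pow 6) fun x => (pow_pos (hpos x) 6).ne').mul
      hC1.continuous_deriv_one
  have hFper : Function.Periodic F 1 := by
    intro x
    have hd : deriv h₀ (x + 1) = deriv h₀ x := by
      rw [← deriv_comp_add_const, hper.funext]
    rw [hF, hF, hper x, hd]
  simp only [integral_comp_add_mul_sin hcont hFper, ← ha, ← hb]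
  exact ncard_zeros_first_harmonic hab
end

section
/- Let f(h) = h⁻⁶ − h⁻³, and let h : ℝ → ℝ be a continuous, 1-periodic, strictly positive function that is not constant, whose minimum value m := min_{x ∈ [0,1]} h(x) satisfies m < 1. Then ∫₀¹ f(h(x)) dx < f(m). -/
open Real

theorem inv_pow_six_sub_inv_pow_three_lt {m y : ℝ} (hm : 0 < m) (hm1 : m < 1) (hmy : m < y) :
    1 / y ^ 6 - 1 / y ^ 3 < 1 / m ^ 6 - 1 / m ^ 3 := by
  have hy : 0 < y := hm.trans hmy
  have hu : 0 < 1 / y ^ 3 := by positivity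
  have huv : 1 / y ^ 3 < 1 / m ^ 3 := by gcongr
  have hv : 1 < 1 / m ^ 3 :=
    (one_lt_div (by positivity)).2 (pow_lt_one₀ hm.le hm1 (by norm_num))
  have sq (z : ℝ) : 1 / z ^ 6 = (1 / z ^ 3) ^ 2 := by rw [div_pow, one_pow, ← pow_mul]
  rw [sq, sq]
  nlinarith [mul_pos (sub_pos.2 huv) (add_pos hu (sub_pos.2 hv))]

theorem integral_strictly_below_value_at_minimum
    (f : ℝ → ℝ) (hf : ∀ y : ℝ, f y = 1 / y ^ 6 - 1 / y ^ 3)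
    (h : ℝ → ℝ) (hcont : Continuous h) (hper : Function.Periodic h 1)
    (hpos : ∀ x, 0 < h x) (hnc : ∃ x y, h x ≠ h y)
    (m : ℝ) (hm : IsLeast (h '' Set.Icc 0 1) m) (hm1 : m < 1) :
    (∫ x in (0:ℝ)..1, f (h x)) < f m := by
  obtain ⟨⟨x₀, -, hx₀⟩, hmin⟩ := hm
  have hm0 : 0 < m := hx₀ ▸ hpos x₀
  have hlt : ∀ y, m < y → f y < f m := fun y hy => by
    rw [hf, hf]
    exact inv_pow_six_sub_inv_pow_three_lt hm0 hm1 hy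
  have hle : ∀ x ∈ Set.Icc (0 : ℝ) 1, m ≤ h x := fun x hx => hmin ⟨x, hx, rfl⟩
  have hex : ∃ c ∈ Set.Icc (0 : ℝ) 1, m < h c := by
    by_contra! hall
    have hconst (x : ℝ) : h x = m := by
      obtain ⟨y, hy, hxy⟩ := hper.exists_mem_Ico₀ one_pos x
      have hy' := Set.Ico_subset_Icc_self hy
      exact hxy.trans (le_antisymm (hall y hy') (hle y hy'))
    obtain ⟨x, y, hxy⟩ := hnc
    exact hxy ((hconst x).trans (hconst y).symm)
  have hfc : Continuous fun x => f (h x) := by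
    simp only [hf]
    exact (continuous_const.div (hcont.pow 6) fun x => (pow_pos (hpos x) 6).ne').sub
      (continuous_const.div (hcont.pow 3) fun x => (pow_pos (hpos x) 3).ne')
  obtain ⟨c, hc, hmc⟩ := hex
  have key := intervalIntegral.integral_lt_integral_of_continuousOn_of_le_of_exists_lt
    (g := fun _ => f m) one_pos hfc.continuousOn continuousOn_const
    (fun x hx => (hle x (Set.Ioc_subset_Icc_self hx)).eq_or_lt.elim
      (fun he => by rw [← he]) fun hl => (hlt _ hl).le) ⟨c, hc, hlt _ hmc⟩
  simpa using key
end
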